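/- arXiv:1601.06035 — 3 statements merged into one kernel-verified Lean document; each statement's English description precedes it below -/
import Mathlib

section
/- Let Z, U, I be positive integers and set D = Z. Suppose (p_u)_{u∈[U]}, (E_{iz})_{i∈[I], z∈[Z]} is a D-dimensional normalized nonnegative model (each p_u is a D-dimensional probability vector, each E_{iz} ∈ ℝ^D has nonnegative entries, and Σ_{z=1}^Z E_{iz} = (1,...,1)^T for each i) satisfying: (i) for every (i,z) ∈ [I]×[Z] there exists u ∈ [U] with p_u^T E_{iz} = 1; (ii) for every u ∈ [U] there exist (i,z) ∈ [I]×[Z] with p_u^T E_{iz} = 1. Let (ρ_u)_u, (F_{iz})_{iz} be any D-dimensional quantum model (each ρ_u a density matrix on ℂ^D, each (F_{i1},...,F_{iZ}) a POVM on ℂ^D) satisfying tr(ρ_u F_{iz}) = p_u^T E_{iz} for all u, i, z. Then there exists a unitary D×D matrix V such that V p_u p_u^T V^* = ρ_u for all u ∈ [U] and V E_{iz} E_{iz}^T V^* = F_{iz} for all i ∈ [I], z ∈ [Z]. -/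
open Matrix BigOperators
open scoped ComplexOrder

section Stochastic

variable {n : Type*} [Fintype n]

lemma eq_zero_or_eq_one_of_sum_mul_eq_one {q e : n → ℝ} (hq : ∀ j, 0 ≤ q j)
    (hq1 : ∑ j, q j = 1) (he : ∀ j, e j ≤ 1) (h : ∑ j, q j * e j = 1) (j : n) :
    q j = 0 ∨ e j = 1 := by
  have hz : ∑ j, q j * (1 - e j) = 0 := by
    simp [mul_sub, Finset.sum_sub_distrib, hq1, h]
  have := (Finset.sum_eq_zero_iff_of_nonneg
    (fun j _ => mul_nonneg (hq j) (sub_nonneg.2 (he j)))).1 hz j (Finset.mem_univ j)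
  rcases mul_eq_zero.1 this with h0 | h1
  · exact Or.inl h0
  · exact Or.inr (by linarith)

variable [DecidableEq n]

/-- A column-stochastic square matrix having an entry `1` in every row is a permutation matrix. -/
lemma exists_perm_of_forall_exists_eq_one {e : n → n → ℝ} (he : ∀ z j, 0 ≤ e z j)
    (he1 : ∀ j, ∑ z, e z j = 1) (h : ∀ z, ∃ j, e z j = 1) :
    ∃ σ : Equiv.Perm n, ∀ z, e z = Pi.single (σ z) 1 := by
  choose τ hτ using h
  have hzero : ∀ z z', z ≠ z' → e z (τ z') = 0 := by
    intro z z' hne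
    have hs := he1 (τ z')
    rw [← Finset.add_sum_erase _ _ (Finset.mem_univ z'), hτ] at hs
    exact (Finset.sum_eq_zero_iff_of_nonneg (fun w _ => he w _)).1
      (by linarith) z (by simp [hne])
  have hinj : Function.Injective τ := by
    intro z z' hzz
    by_contra hne
    have := hzero z z' hne
    rw [← hzz, hτ] at this
    exact one_ne_zero this
  refine ⟨Equiv.ofBijective τ (Finite.injective_iff_bijective.1 hinj), fun z => ?_⟩
  funext j
  obtain ⟨z', rfl⟩ := (Finite.injective_iff_surjective.1 hinj) j
  rw [Equiv.ofBijective_apply]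
  by_cases hz : z = z'
  · subst hz
    simp [hτ]
  · rw [hzero z z' hz, Pi.single_eq_of_ne (fun hc => hz (hinj hc).symm)]

end Stochastic

namespace Matrix

variable {n : Type*} [Fintype n]

lemma IsHermitian.exists_eq_vecMulVec_of_isIdempotentElem {P : Matrix n n ℂ}
    (hP : P.IsHermitian) (hPP : IsIdempotentElem P) (hP1 : P.trace = 1) :
    ∃ v : n → ℂ, P = vecMulVec v (star v) := by
  have hne : P ≠ 0 := by
    rintro rfl
    simp at hP1
  obtain ⟨v, t, ht, hv, hPv⟩ := hP.exists_eigenvector_of_ne_zero hne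
  have hw : P *ᵥ ((t : ℂ) • v) = (t : ℂ) • v := by
    have hPv' : P *ᵥ v = (t : ℂ) • v := by rw [hPv]; ext; simp
    rw [← hPv', mulVec_mulVec, hPP.eq]
  obtain ⟨c, hc⟩ : ∃ c : ℝ, (c : ℂ) * c * (star v ⬝ᵥ v) = 1 := by
    have hpos : 0 < star v ⬝ᵥ v := dotProduct_star_self_pos_iff.2 hv
    obtain ⟨r, hr⟩ : ∃ r : ℝ, star v ⬝ᵥ v = r := ⟨_, Complex.eq_re_of_ofReal_le hpos.le⟩
    rw [hr] at hpos ⊢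
    have hr0 : 0 < r := by exact_mod_cast hpos
    refine ⟨(Real.sqrt r)⁻¹, ?_⟩
    have : (Real.sqrt r)⁻¹ * (Real.sqrt r)⁻¹ * r = 1 := by
      rw [← mul_inv, Real.mul_self_sqrt hr0.le, inv_mul_cancel₀ hr0.ne']
    exact_mod_cast this
  have hfix : P *ᵥ ((c : ℂ) • v) = (c : ℂ) • v := by
    rw [mulVec_smul] at hw ⊢
    rw [smul_right_injective _ (Complex.ofReal_ne_zero.2 ht) hw]
  have hnorm : star ((c : ℂ) • v) ⬝ᵥ ((c : ℂ) • v) = 1 := by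
    rw [← hc]
    simp [mul_assoc]
  generalize (c : ℂ) • v = x at hfix hnorm
  refine ⟨x, sub_eq_zero.1 ?_⟩
  have hfix' : star x ᵥ* P = star x := by
    have := congrArg star hfix
    rwa [star_mulVec, hP.eq] at this
  have hQ : (P - vecMulVec x (star x))ᴴ * (P - vecMulVec x (star x)) =
      P - vecMulVec x (star x) := by
    rw [conjTranspose_sub, hP.eq, conjTranspose_vecMulVec, star_star, Matrix.mul_sub,
      Matrix.sub_mul, Matrix.sub_mul, hPP.eq, mul_vecMulVec, vecMulVec_mul,
      vecMulVec_mul_vecMulVec, hfix, hfix', hnorm, one_smul, sub_self, sub_zero]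
  rw [← trace_conjTranspose_mul_self_eq_zero_iff, hQ, trace_sub, hP1, trace_vecMulVec,
    dotProduct_comm, hnorm, sub_self]

variable [DecidableEq n]

open scoped MatrixOrder in
lemma PosSemidef.exists_eq_conjTranspose_mul_self {A : Matrix n n ℂ} (hA : A.PosSemidef) :
    ∃ X : Matrix n n ℂ, A = Xᴴ * X :=
  CStarAlgebra.nonneg_iff_eq_star_mul_self.mp (nonneg_iff_posSemidef.2 hA)

lemma PosSemidef.trace_mul_nonneg {A B : Matrix n n ℂ} (hA : A.PosSemidef) (hB : B.PosSemidef) :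
    0 ≤ (A * B).trace := by
  obtain ⟨X, rfl⟩ := hA.exists_eq_conjTranspose_mul_self
  rw [Matrix.mul_assoc, trace_mul_comm]
  exact (hB.mul_mul_conjTranspose_same X).trace_nonneg

lemma PosSemidef.mul_eq_zero_of_trace_mul_eq_zero {A B : Matrix n n ℂ} (hA : A.PosSemidef)
    (hB : B.PosSemidef) (h : (A * B).trace = 0) : A * B = 0 := by
  obtain ⟨X, rfl⟩ := hA.exists_eq_conjTranspose_mul_self
  obtain ⟨Y, rfl⟩ := hB.exists_eq_conjTranspose_mul_self
  have hXY : (X * Yᴴ)ᴴ * (X * Yᴴ) = Y * (Xᴴ * X * Yᴴ) := by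
    simp [Matrix.mul_assoc]
  have h0 : X * Yᴴ = 0 := by
    rw [← trace_conjTranspose_mul_self_eq_zero_iff, hXY, trace_mul_comm, Matrix.mul_assoc _ Yᴴ, h]
  rw [Matrix.mul_assoc, ← Matrix.mul_assoc X, h0, Matrix.zero_mul, Matrix.mul_zero]

lemma PosSemidef.one_sub_of_trace_eq_one {A : Matrix n n ℂ} (hA : A.PosSemidef)
    (h : A.trace = 1) : (1 - A).PosSemidef := by
  have hle : ∀ i, hA.1.eigenvalues i ≤ 1 := by
    intro i
    have hs : ∑ i, hA.1.eigenvalues i = 1 := by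
      have : ∑ i, (hA.1.eigenvalues i : ℂ) = 1 := h ▸ hA.1.trace_eq_sum_eigenvalues.symm
      exact_mod_cast this
    rw [← hs]
    exact Finset.single_le_sum (fun j _ => hA.eigenvalues_nonneg j) (Finset.mem_univ i)
  have hU := hA.1.eigenvectorUnitary.2
  have hspec := hA.1.spectral_theorem
  rw [Unitary.conjStarAlgAut_apply] at hspec
  have hsub : 1 - A = (hA.1.eigenvectorUnitary : Matrix n n ℂ) *
      diagonal (fun i => 1 - (hA.1.eigenvalues i : ℂ)) *
      (hA.1.eigenvectorUnitary : Matrix n n ℂ)ᴴ := by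
    have hd : diagonal (fun i => 1 - (hA.1.eigenvalues i : ℂ)) =
        1 - diagonal (RCLike.ofReal ∘ hA.1.eigenvalues) := by
      rw [← diagonal_one, diagonal_sub]
      rfl
    rw [hd, Matrix.mul_sub, Matrix.sub_mul, Matrix.mul_one, ← star_eq_conjTranspose, ← hspec,
      Unitary.mul_star_self_of_mem hU]
  rw [hsub]
  refine PosSemidef.mul_mul_conjTranspose_same (PosSemidef.diagonal fun i => ?_) _
  have := hle i
  simpa using (by exact_mod_cast this : ((hA.1.eigenvalues i : ℝ) : ℂ) ≤ 1)

lemma PosSemidef.trace_mul_le {R G : Matrix n n ℂ} (hR : R.PosSemidef) (hR1 : R.trace = 1)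
    (hG : G.PosSemidef) : (R * G).trace ≤ G.trace := by
  have := (hR.one_sub_of_trace_eq_one hR1).trace_mul_nonneg hG
  rwa [Matrix.sub_mul, Matrix.one_mul, trace_sub, sub_nonneg] at this

/-- If an effect of trace one is certain on a state, it equals that state, which is pure. -/
lemma PosSemidef.eq_and_isIdempotentElem_of_trace_mul_eq_one {R G : Matrix n n ℂ}
    (hR : R.PosSemidef) (hR1 : R.trace = 1) (hG : G.PosSemidef) (hG1 : G.trace = 1)
    (h : (R * G).trace = 1) : R = G ∧ IsIdempotentElem R := by
  have h1 : (1 - R) * G = 0 :=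
    (hR.one_sub_of_trace_eq_one hR1).mul_eq_zero_of_trace_mul_eq_zero hG
      (by rw [Matrix.sub_mul, Matrix.one_mul, trace_sub, h, hG1, sub_self])
  have h2 : R * (1 - G) = 0 :=
    hR.mul_eq_zero_of_trace_mul_eq_zero (hG.one_sub_of_trace_eq_one hG1)
      (by rw [Matrix.mul_sub, Matrix.mul_one, trace_sub, h, hR1, sub_self])
  rw [Matrix.sub_mul, Matrix.one_mul, sub_eq_zero] at h1
  rw [Matrix.mul_sub, Matrix.mul_one, sub_eq_zero] at h2
  have hRG : R = G := h2.trans h1.symm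
  exact ⟨hRG, by rw [IsIdempotentElem]; nth_rewrite 2 [hRG]; exact h2.symm⟩

/-- A POVM with as many outcomes as the dimension, each of which is certain on some state,
consists of effects of trace one. -/
lemma trace_eq_one_of_povm {G R : n → Matrix n n ℂ} (hG : ∀ z, (G z).PosSemidef)
    (hG1 : ∑ z, G z = 1) (hR : ∀ z, (R z).PosSemidef) (hR1 : ∀ z, (R z).trace = 1)
    (h : ∀ z, (R z * G z).trace = 1) (z : n) : (G z).trace = 1 := by
  have hge : ∀ z, 0 ≤ (G z).trace - 1 := fun z =>
    sub_nonneg.2 (h z ▸ (hR z).trace_mul_le (hR1 z) (hG z))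
  have hs : ∑ z, ((G z).trace - 1) = 0 := by
    rw [Finset.sum_sub_distrib, ← trace_sum, hG1]
    simp
  exact sub_eq_zero.1 ((Finset.sum_eq_zero_iff_of_nonneg fun z _ => hge z).1 hs z
    (Finset.mem_univ z))

/-- A resolution of the identity into rank-one operators indexed by the dimension is unitarily
equivalent to the one given by the standard basis. -/
lemma exists_unitary_of_vecMulVec {P : n → Matrix n n ℂ} (hP1 : ∑ j, P j = 1)
    (hP : ∀ j, ∃ v : n → ℂ, P j = vecMulVec v (star v)) :
    ∃ V ∈ unitaryGroup n ℂ, ∀ j,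
      V * vecMulVec (Pi.single j 1) (Pi.single j 1) * Vᴴ = P j := by
  choose v hv using hP
  refine ⟨(of v)ᵀ, ?_, fun j => ?_⟩
  · rw [mem_unitaryGroup_iff, ← hP1]
    ext a b
    simp [mul_apply, sum_apply, hv, vecMulVec_apply, star_apply]
  · rw [mul_vecMulVec, vecMulVec_mul, hv]
    ext a b
    simp [vecMulVec_apply]

end Matrix

/-- If a `Z`-dimensional NNM (with `D = Z`) is such that for every item/outcome
pair some user gives it probability one, and every user gives some item/outcome
probability one, then any `Z`-dimensional quantum model reproducing the same
probabilities is unitarily equivalent to the outer-product embedding of the NNM. -/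
theorem nnm_recoverable_from_quantum_model
    (Z U I : ℕ) (hZ : 0 < Z) (hU : 0 < U) (hI : 0 < I)
    -- the NNM
    (p : Fin U → Fin Z → ℝ)
    (hp_nonneg : ∀ u j, 0 ≤ p u j) (hp_sum : ∀ u, ∑ j, p u j = 1)
    (E : Fin I → Fin Z → Fin Z → ℝ)
    (hE_nonneg : ∀ i z j, 0 ≤ E i z j)
    (hE_sum : ∀ i j, ∑ z, E i z j = 1)
    -- condition (i)
    (hi : ∀ i : Fin I, ∀ z : Fin Z, ∃ u : Fin U, ∑ j, p u j * E i z j = 1)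
    -- condition (ii)
    (hii : ∀ u : Fin U, ∃ i : Fin I, ∃ z : Fin Z, ∑ j, p u j * E i z j = 1)
    -- the quantum model
    (ρ : Fin U → Matrix (Fin Z) (Fin Z) ℂ)
    (hρ_psd : ∀ u, (ρ u).PosSemidef) (hρ_tr : ∀ u, (ρ u).trace = 1)
    (F : Fin I → Fin Z → Matrix (Fin Z) (Fin Z) ℂ)
    (hF_psd : ∀ i z, (F i z).PosSemidef)
    (hF_sum : ∀ i, ∑ z, F i z = (1 : Matrix (Fin Z) (Fin Z) ℂ))
    -- the quantum model reproduces the NNM probabilities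
    (hmatch : ∀ u i z, (ρ u * F i z).trace = ((∑ j, p u j * E i z j : ℝ) : ℂ)) :
    ∃ V : Matrix (Fin Z) (Fin Z) ℂ, V ∈ Matrix.unitaryGroup (Fin Z) ℂ ∧
      (∀ u, V * Matrix.vecMulVec (fun j => (p u j : ℂ)) (fun j => (p u j : ℂ)) * Vᴴ
        = ρ u) ∧
      (∀ i z, V * Matrix.vecMulVec (fun j => (E i z j : ℂ)) (fun j => (E i z j : ℂ)) * Vᴴ
        = F i z) := by
  classical
  have hE_le : ∀ i z j, E i z j ≤ 1 := fun i z j =>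
    hE_sum i j ▸ Finset.single_le_sum (fun w _ => hE_nonneg i w j) (Finset.mem_univ z)
  have hp_ne : ∀ u, ∃ j, p u j ≠ 0 := by
    intro u
    by_contra! hc
    simpa [hc] using hp_sum u
  have hcert : ∀ {u i z}, ∑ j, p u j * E i z j = 1 → ∀ j, p u j = 0 ∨ E i z j = 1 :=
    fun {u i z} h => eq_zero_or_eq_one_of_sum_mul_eq_one (hp_nonneg u) (hp_sum u) (hE_le i z) h
  have hperm : ∀ i, ∃ σ : Equiv.Perm (Fin Z), ∀ z, E i z = Pi.single (σ z) 1 := by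
    refine fun i => exists_perm_of_forall_exists_eq_one (hE_nonneg i) (hE_sum i) fun z => ?_
    obtain ⟨u, hu⟩ := hi i z
    obtain ⟨j, hj⟩ := hp_ne u
    exact ⟨j, (hcert hu j).resolve_left hj⟩
  choose σ hσ using hperm
  have hpure : ∀ u, ∃ s, p u = Pi.single s 1 := by
    intro u
    obtain ⟨i, z, h⟩ := hii u
    have hoff : ∀ j, j ≠ σ i z → p u j = 0 := fun j hj =>
      (hcert h j).resolve_right (by simp [hσ, hj])
    refine ⟨σ i z, funext fun j => ?_⟩
    by_cases hj : j = σ i z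
    · rw [hj, Pi.single_eq_same, ← hp_sum u, Fintype.sum_eq_single _ hoff]
    · rw [hoff j hj, Pi.single_eq_of_ne hj]
  choose s hs using hpure
  have hmatch_one : ∀ {u i z}, s u = σ i z → (ρ u * F i z).trace = 1 := by
    intro u i z h
    rw [hmatch, hs, hσ, h]
    simp [Pi.single_apply]
  have hsurj : ∀ i z, ∃ u, s u = σ i z := by
    intro i z
    obtain ⟨u, hu⟩ := hi i z
    have := (hcert hu (s u)).resolve_left (by simp [hs])
    refine ⟨u, ?_⟩
    by_contra hne
    simp [hσ, hne] at this
  have hF_tr : ∀ i z, (F i z).trace = 1 := by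
    intro i
    choose r hr using hsurj i
    exact trace_eq_one_of_povm (hF_psd i) (hF_sum i) (fun z => hρ_psd (r z))
      (fun z => hρ_tr (r z)) fun z => hmatch_one (hr z)
  have hkey : ∀ {u i z}, s u = σ i z → ρ u = F i z ∧ IsIdempotentElem (ρ u) := fun h =>
    (hρ_psd _).eq_and_isIdempotentElem_of_trace_mul_eq_one (hρ_tr _) (hF_psd _ _) (hF_tr _ _)
      (hmatch_one h)
  let k : Fin I := ⟨0, hI⟩
  obtain ⟨V, hV, hVP⟩ := exists_unitary_of_vecMulVec (P := fun j => F k ((σ k).symm j))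
    ((Equiv.sum_comp (σ k).symm (F k)).trans (hF_sum k)) fun j => by
      obtain ⟨u, hu⟩ := hsurj k ((σ k).symm j)
      obtain ⟨h1, h2⟩ := hkey hu
      exact (hF_psd _ _).1.exists_eq_vecMulVec_of_isIdempotentElem (h1 ▸ h2) (hF_tr _ _)
  have hcast : ∀ j : Fin Z,
      (fun l => ((Pi.single j 1 : Fin Z → ℝ) l : ℂ)) = Pi.single j 1 := by
    intro j
    ext l
    simp only [Pi.single_apply]
    split_ifs <;> simp
  have hρV : ∀ u, V * vecMulVec (Pi.single (s u) 1) (Pi.single (s u) 1) * Vᴴ = ρ u :=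
    fun u => (hVP (s u)).trans (hkey (by simp)).1.symm
  refine ⟨V, hV, fun u => ?_, fun i z => ?_⟩
  · rw [hs, hcast, hρV]
  · obtain ⟨u, hu⟩ := hsurj i z
    rw [hσ, hcast, ← hu, hρV, (hkey hu).1]
end

section
/- Let Z be a positive integer and let E_1, ..., E_Z be Hermitian positive semidefinite complex Z×Z matrices with Σ_{z=1}^Z E_z = I (a POVM on ℂ^Z whose number of outcomes equals the dimension). If ‖E_z‖_F ≥ 1 for every z ∈ {1,...,Z}, then ‖E_z‖_F = 1 for every z, and tr(E_z E_{z'}) = 0 for all z ≠ z'. -/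
open Matrix BigOperators
open scoped ComplexOrder

/-- The Frobenius norm `√(tr(A* A))` of a matrix. -/
noncomputable def frobeniusNorm {D : ℕ} (A : Matrix (Fin D) (Fin D) ℂ) : ℝ :=
  Real.sqrt ((Aᴴ * A).trace.re)

/-- The trace of a product of two positive semidefinite matrices is nonnegative. -/
theorem Matrix.PosSemidef.trace_mul_nonneg_of_posSemidef {n : Type*} [Fintype n] [DecidableEq n]
    {A B : Matrix n n ℂ} (hA : A.PosSemidef) (hB : B.PosSemidef) : 0 ≤ (A * B).trace := by
  obtain ⟨C, rfl⟩ : ∃ C : Matrix n n ℂ, B = Cᴴ * C := by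
    open scoped MatrixOrder in
    exact CStarAlgebra.nonneg_iff_eq_star_mul_self.mp hB.nonneg
  rw [← Matrix.mul_assoc, Matrix.trace_mul_comm, ← Matrix.mul_assoc]
  exact (hA.mul_mul_conjTranspose_same C).trace_nonneg

/-- If a positive semidefinite matrix has Frobenius norm at least one, its square has trace at
least one. -/
theorem Matrix.PosSemidef.one_le_trace_mul_self {D : ℕ} {A : Matrix (Fin D) (Fin D) ℂ}
    (hA : A.PosSemidef) (h : 1 ≤ frobeniusNorm A) : 1 ≤ (A * A).trace := by
  rw [frobeniusNorm, hA.isHermitian.eq, Real.one_le_sqrt] at h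
  have h0 := Complex.le_def.mp (hA.trace_mul_nonneg_of_posSemidef hA)
  exact Complex.le_def.mpr ⟨h, h0.2⟩

/-- For a POVM on `ℂ^Z` with `Z` outcomes, if each element has Frobenius norm
at least one, then each has Frobenius norm exactly one and distinct elements
are trace-orthogonal. -/
theorem povm_frobenius_norms_eq_one
    {Z : ℕ} (hZ : 0 < Z) (E : Fin Z → Matrix (Fin Z) (Fin Z) ℂ)
    (hE_psd : ∀ z, (E z).PosSemidef)
    (hE_sum : ∑ z, E z = (1 : Matrix (Fin Z) (Fin Z) ℂ))
    (hF : ∀ z, 1 ≤ frobeniusNorm (E z)) :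
    (∀ z, frobeniusNorm (E z) = 1) ∧
    (∀ z z', z ≠ z' → (E z * E z').trace = 0) := by
  have hnn z z' : 0 ≤ (E z * E z').trace :=
    (hE_psd z).trace_mul_nonneg_of_posSemidef (hE_psd z')
  have hdiag z : 1 ≤ (E z * E z).trace := (hE_psd z).one_le_trace_mul_self (hF z)
  have hrow z : ∑ z', (E z * E z').trace = (E z).trace := by
    rw [← Matrix.trace_sum, ← Finset.mul_sum, hE_sum, Matrix.mul_one]
  have hle z : (E z * E z).trace ≤ (E z).trace := by
    rw [← hrow z]
    exact Finset.single_le_sum (fun z' _ => hnn z z') (Finset.mem_univ z)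
  have htotal : ∑ _z : Fin Z, (1 : ℂ) = ∑ z, (E z).trace := by
    rw [← Matrix.trace_sum, hE_sum]
    simp
  have htrace z : 1 = (E z).trace :=
    (Finset.sum_eq_sum_iff_of_le fun z _ => (hdiag z).trans (hle z)).mp htotal z
      (Finset.mem_univ z)
  have hsq z : (E z * E z).trace = 1 :=
    le_antisymm ((hle z).trans (htrace z).ge) (hdiag z)
  refine ⟨fun z => ?_, fun z z' hzz' => ?_⟩
  · rw [frobeniusNorm, (hE_psd z).isHermitian.eq, hsq z, Complex.one_re, Real.sqrt_one]
  · have hoff : ∑ w ∈ Finset.univ.erase z, (E z * E w).trace = 0 := by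
      have h := Finset.add_sum_erase Finset.univ (fun w => (E z * E w).trace)
        (Finset.mem_univ z)
      rw [hrow z, ← htrace z, hsq z] at h
      simpa using h
    exact (Finset.sum_eq_zero_iff_of_nonneg fun w _ => hnn z w).mp hoff z'
      (Finset.mem_erase.mpr ⟨hzz'.symm, Finset.mem_univ z'⟩)
end

section
/- Let Z be a positive integer. Let E_1, ..., E_Z ∈ ℝ^Z have nonnegative entries and satisfy Σ_{z=1}^Z E_z = (1,...,1)^T, and let p_1, ..., p_Z be Z-dimensional probability vectors such that p_z^T E_z = 1 for every z ∈ {1,...,Z}. Then there exists a permutation σ of {1,...,Z} such that E_z = p_z = e_{σ(z)} for every z, where e_k denotes the k-th standard basis vector of ℝ^Z. -/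
open BigOperators

/-- If nonnegative reals sum to the value of one of them, the others vanish. -/
theorem eq_zero_of_sum_eq_apply {ι : Type*} [Fintype ι] {f : ι → ℝ} (hf : ∀ i, 0 ≤ f i)
    {i j : ι} (h : ∑ k, f k = f i) (hij : j ≠ i) : f j = 0 := by
  classical
  rw [← Finset.add_sum_erase _ _ (Finset.mem_univ i), add_eq_left,
    Finset.sum_eq_zero_iff_of_nonneg fun k _ => hf k] at h
  exact h j (by simp [hij])

/-- The classical analog of perfectly distinguishing measurements: if
`E_1,...,E_Z ∈ ℝ^Z` are nonnegative vectors summing (over `z`) to the all-ones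
vector and `p_1,...,p_Z` are probability vectors with `p_zᵀ E_z = 1` for all
`z`, then there is a permutation `σ` of `{1,...,Z}` with
`E_z = p_z = e_{σ(z)}` for all `z`. -/
theorem classical_perfect_distinguishing_is_permutation
    {Z : ℕ} (hZ : 0 < Z)
    (E : Fin Z → Fin Z → ℝ)
    (hE_nonneg : ∀ z j, 0 ≤ E z j)
    (hE_sum : ∀ j, ∑ z, E z j = 1)
    (p : Fin Z → Fin Z → ℝ)
    (hp_nonneg : ∀ z j, 0 ≤ p z j) (hp_sum : ∀ z, ∑ j, p z j = 1)
    (hdist : ∀ z, ∑ j, p z j * E z j = 1) :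
    ∃ σ : Equiv.Perm (Fin Z),
      ∀ z, E z = Pi.single (σ z) (1 : ℝ) ∧ p z = Pi.single (σ z) (1 : ℝ) := by
  have hE_le (z j) : E z j ≤ 1 := by
    rw [← hE_sum j]
    exact Finset.single_le_sum (fun w _ => hE_nonneg w j) (Finset.mem_univ z)
  have hslack (z j) : p z j * (1 - E z j) = 0 := by
    have hsum : ∑ j, p z j * (1 - E z j) = 0 := by
      simp [mul_sub, Finset.sum_sub_distrib, hp_sum, hdist]
    exact (Finset.sum_eq_zero_iff_of_nonneg fun k _ =>
      mul_nonneg (hp_nonneg z k) (sub_nonneg.2 (hE_le z k))).1 hsum j (Finset.mem_univ j)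
  have hone (z) : ∃ j, E z j = 1 := by
    obtain ⟨j, -, hj⟩ := Finset.exists_ne_zero_of_sum_ne_zero
      ((hp_sum z).trans_ne one_ne_zero)
    exact ⟨j, (sub_eq_zero.1 ((mul_eq_zero.1 (hslack z j)).resolve_left hj)).symm⟩
  choose f hf using hone
  have hE_zero {z w} (h : z ≠ w) : E z (f w) = 0 :=
    eq_zero_of_sum_eq_apply (f := fun z => E z (f w)) (fun z => hE_nonneg z _)
      ((hE_sum _).trans (hf w).symm) h
  have hf_inj : Function.Injective f := fun z w h => by
    by_contra hzw
    have := hE_zero hzw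
    rw [← h, hf z] at this
    exact one_ne_zero this
  let σ := Equiv.ofBijective f (Finite.injective_iff_bijective.1 hf_inj)
  refine ⟨σ, fun z => ?_⟩
  have hE : E z = Pi.single (σ z) 1 := by
    ext j
    obtain ⟨w, rfl⟩ := σ.surjective j
    rcases eq_or_ne z w with rfl | h
    · rw [Pi.single_eq_same]
      exact hf z
    · rw [Pi.single_eq_of_ne (σ.injective.ne h.symm)]
      exact hE_zero h
  have hp_zero (j) (hj : j ≠ σ z) : p z j = 0 := by
    simpa [hE, hj] using hslack z j
  refine ⟨hE, ?_⟩
  ext j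
  rcases eq_or_ne j (σ z) with rfl | hj
  · rw [Pi.single_eq_same, ← hp_sum z]
    exact (Fintype.sum_eq_single _ hp_zero).symm
  · rw [Pi.single_eq_of_ne hj, hp_zero j hj]
end
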